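/- Let n ≥ 3, let p, q be real numbers with p ≠ q, p ≥ (n+2)/(n−2) and q ≥ (n+2)/(n−2), and let R > 0. Then there is no pair of functions u, v, each twice continuously differentiable on a neighborhood of the closed ball B̄_R ⊂ ℝ^n, such that −Δu = v^p + v^q − u^p and −Δv = u^p in B_R, u > 0 and v > 0 in B_R, and u = v = 0 on ∂B_R. -/

import Mathlib

noncomputable section
open Set Metric
open scoped BigOperators

/-- The Laplace operator on `ℝ^n`, as the sum of second partial derivatives. -/
def lap {n : ℕ} (u : EuclideanSpace ℝ (Fin n) → ℝ) (x : EuclideanSpace ℝ (Fin n)) : ℝ :=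
  ∑ i, fderiv ℝ (fun y => fderiv ℝ u y (EuclideanSpace.single i 1)) x (EuclideanSpace.single i 1)

open MeasureTheory in
theorem integrable_mul_of_tsupport_subset {n : ℕ} {U : Set (EuclideanSpace ℝ (Fin n))}
    {φ f : EuclideanSpace ℝ (Fin n) → ℝ} (hφ : Continuous φ) (hc : HasCompactSupport φ)
    (hφU : tsupport φ ⊆ U) (hf : ContinuousOn f U) : Integrable (fun x => φ x * f x) := by
  have h : IntegrableOn (fun x => φ x * f x) (tsupport φ) :=
    (hφ.continuousOn.mul (hf.mono hφU)).integrableOn_compact hc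
  refine (integrableOn_iff_integrable_of_support_subset ?_).1 h
  exact (Function.support_mul_subset_left φ f).trans (subset_tsupport φ)

theorem continuousOn_fderiv_apply {n : ℕ} {U : Set (EuclideanSpace ℝ (Fin n))} (hU : IsOpen U)
    {f : EuclideanSpace ℝ (Fin n) → ℝ} (hf : ContDiffOn ℝ 1 f U) (e : EuclideanSpace ℝ (Fin n)) :
    ContinuousOn (fun x => fderiv ℝ f x e) U :=
  (hf.continuousOn_fderiv_of_isOpen hU le_rfl).clm_apply continuousOn_const

open MeasureTheory in
/-- Integration by parts of the divergence against a compactly supported cutoff. -/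
theorem integral_mul_divergence {n : ℕ} {U : Set (EuclideanSpace ℝ (Fin n))} (hU : IsOpen U)
    {φ : EuclideanSpace ℝ (Fin n) → ℝ} (hφ : ContDiff ℝ 1 φ) (hc : HasCompactSupport φ)
    (hφU : tsupport φ ⊆ U) {F : Fin n → EuclideanSpace ℝ (Fin n) → ℝ}
    (hF : ∀ i, ContDiffOn ℝ 1 (F i) U) :
    ∫ x, φ x * ∑ i, fderiv ℝ (F i) x (EuclideanSpace.single i 1) =
      - ∫ x, ∑ i, fderiv ℝ φ x (EuclideanSpace.single i 1) * F i x := by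
  have hs : ∀ e, HasCompactSupport (fun x => fderiv ℝ φ x e) := fun e => hc.fderiv_apply ℝ e
  have hts : ∀ e, tsupport (fun x => fderiv ℝ φ x e) ⊆ U := fun e =>
    (tsupport_fderiv_apply_subset ℝ e).trans hφU
  have hcont : ∀ e, Continuous (fun x => fderiv ℝ φ x e) := fun e =>
    (hφ.continuous_fderiv (by norm_num)).clm_apply continuous_const
  have h1 : ∀ i, Integrable (fun x => φ x * fderiv ℝ (F i) x (EuclideanSpace.single i 1)) :=
    fun i => integrable_mul_of_tsupport_subset hφ.continuous hc hφU
      (continuousOn_fderiv_apply hU (hF i) _)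
  have h2 : ∀ i, Integrable (fun x => fderiv ℝ φ x (EuclideanSpace.single i 1) * F i x) :=
    fun i => integrable_mul_of_tsupport_subset (hcont _) (hs _) (hts _) (hF i).continuousOn
  simp_rw [Finset.mul_sum]
  rw [integral_finsetSum _ fun i _ => h1 i, integral_finsetSum _ fun i _ => h2 i,
    ← Finset.sum_neg_distrib]
  refine Finset.sum_congr rfl fun i _ => ?_
  refine integral_mul_fderiv_eq_neg_fderiv_mul_of_integrable (h2 i) (h1 i)
    (integrable_mul_of_tsupport_subset hφ.continuous hc hφU (hF i).continuousOn) ?_ ?_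
  · exact fun x _ => (hφ.differentiable (by norm_num)) x
  · exact fun x hx => ((hF i).differentiableOn (by norm_num)).differentiableAt
      (hU.mem_nhds (hφU hx))

theorem exists_norm_lt_of_pos_on_sphere {n : ℕ} {R : ℝ} (hR : 0 < R)
    {f : EuclideanSpace ℝ (Fin n) → ℝ}
    (hf : ContinuousOn f (closedBall 0 R)) (hpos : ∀ x ∈ sphere 0 R, 0 < f x) :
    ∃ r, R / 2 ≤ r ∧ r < R ∧ ∀ x, r ≤ ‖x‖ → ‖x‖ ≤ R → 0 < f x := by
  set K := closedBall (0 : EuclideanSpace ℝ (Fin n)) R ∩ f ⁻¹' Iic 0 with hK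
  have hKc : IsCompact K := (isCompact_closedBall _ _).of_isClosed_subset
    (hf.preimage_isClosed_of_isClosed isClosed_closedBall isClosed_Iic) inter_subset_left
  rcases K.eq_empty_or_nonempty with h | h
  · refine ⟨R / 2, le_rfl, by linarith, fun x _ hx => ?_⟩
    by_contra! hfx
    have : x ∈ K := ⟨by simpa using hx, hfx⟩
    simp [h] at this
  · obtain ⟨y, hy, hmax⟩ := hKc.exists_isMaxOn h continuous_norm.continuousOn
    have hyR : ‖y‖ < R := by
      refine lt_of_le_of_ne (by simpa using hy.1) fun h => ?_
      exact absurd (hpos y (by simpa using h)) (not_lt.2 hy.2)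
    refine ⟨max (R / 2) ((‖y‖ + R) / 2), le_max_left _ _, max_lt (by linarith) (by linarith),
      fun x hx hxR => ?_⟩
    by_contra! hfx
    have hxy : ‖x‖ ≤ ‖y‖ := hmax (show x ∈ K from ⟨by simpa using hxR, hfx⟩)
    have := (le_max_right _ _).trans hx
    linarith

open MeasureTheory in
/-- If a vector field points outwards on the sphere, then its divergence has nonnegative integral
against some radial cutoff of the ball. -/
theorem exists_cutoff_integral_divergence_nonneg {n : ℕ} {R : ℝ} (hR : 0 < R)
    {U : Set (EuclideanSpace ℝ (Fin n))} (hU : IsOpen U) (hRU : closedBall 0 R ⊆ U)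
    {F : Fin n → EuclideanSpace ℝ (Fin n) → ℝ} (hF : ∀ i, ContDiffOn ℝ 1 (F i) U)
    (hpos : ∀ x ∈ sphere 0 R, 0 < ∑ i, x i * F i x) :
    ∃ φ : EuclideanSpace ℝ (Fin n) → ℝ, (∀ x, 0 ≤ φ x) ∧ (∀ x, φ x ≤ 1) ∧
      (∀ x ∈ closedBall 0 (R / 2), φ x = 1) ∧ (∀ x ∉ ball 0 R, φ x = 0) ∧
      Integrable (fun x => φ x * ∑ i, fderiv ℝ (F i) x (EuclideanSpace.single i 1)) ∧
      0 ≤ ∫ x, φ x * ∑ i, fderiv ℝ (F i) x (EuclideanSpace.single i 1) := by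
  obtain ⟨r, hr2, hrR, hr⟩ := exists_norm_lt_of_pos_on_sphere (f := fun x => ∑ i, x i * F i x) hR
    (continuousOn_finsetSum _ fun i _ => ContinuousOn.mul (by fun_prop)
      ((hF i).continuousOn.mono hRU)) hpos
  obtain ⟨s, hrs, hsR⟩ := exists_between hrR
  have hr0 : 0 < r := by linarith
  have hd : 0 < s ^ 2 - r ^ 2 := by nlinarith
  set t : EuclideanSpace ℝ (Fin n) → ℝ := fun x => (s ^ 2 - ‖x‖ ^ 2) / (s ^ 2 - r ^ 2) with ht
  set φ : EuclideanSpace ℝ (Fin n) → ℝ := fun x => Real.smoothTransition (t x) with hφdef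
  have htd : ContDiff ℝ 1 t := by
    have : ContDiff ℝ 1 fun x : EuclideanSpace ℝ (Fin n) => ‖x‖ ^ 2 := contDiff_norm_sq ℝ
    exact (contDiff_const.sub this).div_const _
  have hφ : ContDiff ℝ 1 φ := (Real.smoothTransition.contDiff (n := 1)).comp htd
  have hsupp : tsupport φ ⊆ closedBall 0 s := by
    refine closure_minimal (fun x hx => ?_) isClosed_closedBall
    by_contra hxs
    simp only [mem_closedBall, dist_zero_right, not_le] at hxs
    refine hx (Real.smoothTransition.zero_of_nonpos ?_)
    exact div_nonpos_of_nonpos_of_nonneg (by nlinarith) hd.le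
  have hc : HasCompactSupport φ := (isCompact_closedBall _ _).of_isClosed_subset
    (isClosed_tsupport _) hsupp
  have hφU : tsupport φ ⊆ U := hsupp.trans ((closedBall_subset_closedBall hsR.le).trans hRU)
  have hone : ∀ x, ‖x‖ ≤ r → 1 ≤ t x := fun x hx => by
    rw [ht, one_le_div hd]
    nlinarith [norm_nonneg x]
  refine ⟨φ, fun x => Real.smoothTransition.nonneg _, fun x => Real.smoothTransition.le_one _,
    fun x hx => Real.smoothTransition.one_of_one_le (hone x ?_), fun x hx => ?_, ?_, ?_⟩
  · have : ‖x‖ ≤ R / 2 := by simpa using hx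
    linarith
  · refine image_eq_zero_of_notMem_tsupport fun h => hx ?_
    exact closedBall_subset_ball hsR (hsupp h)
  · exact integrable_mul_of_tsupport_subset hφ.continuous hc hφU
      (continuousOn_finsetSum _ fun i _ => continuousOn_fderiv_apply hU (hF i) _)
  · rw [integral_mul_divergence hU hφ hc hφU hF, ← integral_neg]
    refine integral_nonneg fun x => ?_
    have hder : ∀ e, fderiv ℝ φ x e =
        deriv Real.smoothTransition (t x) * (-(2 * inner ℝ x e) / (s ^ 2 - r ^ 2)) := by
      intro e
      have h1 : HasFDerivAt t ((s ^ 2 - r ^ 2)⁻¹ • (-((2 : ℕ) • innerSL ℝ x))) x := by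
        have := ((hasStrictFDerivAt_norm_sq x).hasFDerivAt.const_sub (s ^ 2)).const_mul
          (s ^ 2 - r ^ 2)⁻¹
        refine this.congr_of_eventuallyEq (Filter.Eventually.of_forall fun y => ?_)
        simp only [ht]
        field_simp
      have h2 : HasDerivAt Real.smoothTransition (deriv Real.smoothTransition (t x)) (t x) :=
        (((Real.smoothTransition.contDiff (n := 1)).differentiable (by norm_num)) _).hasDerivAt
      have h3 : HasFDerivAt φ _ x := h2.comp_hasFDerivAt x h1
      rw [h3.fderiv]
      simp
      ring
    have hnn : 0 ≤ deriv Real.smoothTransition (t x) :=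
      Real.smoothTransition.monotone.deriv_nonneg
    have hsum : -∑ i, fderiv ℝ φ x (EuclideanSpace.single i 1) * F i x =
        2 / (s ^ 2 - r ^ 2) * (deriv Real.smoothTransition (t x) * ∑ i, x i * F i x) := by
      rw [Finset.mul_sum, Finset.mul_sum, ← Finset.sum_neg_distrib]
      refine Finset.sum_congr rfl fun i _ => ?_
      rw [hder]
      simp [EuclideanSpace.inner_single_right]
      ring
    simp only [Pi.zero_apply]
    rw [hsum]
    refine mul_nonneg (by positivity) ?_
    by_cases hxR : ‖x‖ ≤ R
    · by_cases hxr : r ≤ ‖x‖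
      · exact mul_nonneg hnn (hr x hxr hxR).le
      · have h1 : 1 < t x := by
          rw [ht, one_lt_div hd]
          nlinarith [norm_nonneg x]
        have : Real.smoothTransition =ᶠ[nhds (t x)] fun _ => 1 := by
          filter_upwards [lt_mem_nhds h1] with y hy
          exact Real.smoothTransition.one_of_one_le hy.le
        rw [this.deriv_eq]
        simp
    · have h1 : t x < 0 := div_neg_of_neg_of_pos (by nlinarith [norm_nonneg x]) hd
      have : Real.smoothTransition =ᶠ[nhds (t x)] fun _ => 0 := by
        filter_upwards [gt_mem_nhds h1] with y hy
        exact Real.smoothTransition.zero_of_nonpos hy.le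
      rw [this.deriv_eq]
      simp

open MeasureTheory in
/-- A weak form of the divergence theorem on the ball: a vector field with negative divergence
inside the ball cannot have nonnegative normal component on the whole sphere. -/
theorem false_of_divergence_neg {n : ℕ} (hn : 0 < n) {R : ℝ} (hR : 0 < R)
    {U : Set (EuclideanSpace ℝ (Fin n))} (hU : IsOpen U) (hRU : closedBall 0 R ⊆ U)
    {F : Fin n → EuclideanSpace ℝ (Fin n) → ℝ} (hF : ∀ i, ContDiffOn ℝ 1 (F i) U)
    (hnonneg : ∀ x ∈ sphere 0 R, 0 ≤ ∑ i, x i * F i x)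
    (hneg : ∀ x ∈ ball 0 R, ∑ i, fderiv ℝ (F i) x (EuclideanSpace.single i 1) < 0) : False := by
  set D : EuclideanSpace ℝ (Fin n) → ℝ :=
    fun x => ∑ i, fderiv ℝ (F i) x (EuclideanSpace.single i 1) with hD
  have hDc : ContinuousOn D U :=
    continuousOn_finsetSum _ fun i _ => continuousOn_fderiv_apply hU (hF i) _
  have hhalf : closedBall (0 : EuclideanSpace ℝ (Fin n)) (R / 2) ⊆ ball 0 R :=
    closedBall_subset_ball (by linarith)
  obtain ⟨y, hy, hmax⟩ := (isCompact_closedBall (0 : EuclideanSpace ℝ (Fin n))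
    (R / 2)).exists_isMaxOn ⟨0, by simp; positivity⟩
    (hDc.mono (hhalf.trans (ball_subset_closedBall.trans hRU)))
  have hm : 0 < -D y := neg_pos.2 (hneg y (hhalf hy))
  set a := volume.real (closedBall (0 : EuclideanSpace ℝ (Fin n)) (R / 2)) with ha
  set b := volume.real (ball (0 : EuclideanSpace ℝ (Fin n)) R) with hb
  have ha0 : 0 < a := ENNReal.toReal_pos (measure_closedBall_pos _ _ (by positivity)).ne'
    measure_closedBall_lt_top.ne
  have hb0 : 0 < b := ENNReal.toReal_pos (measure_ball_pos _ _ hR).ne' measure_ball_lt_top.ne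
  have hn0 : (0 : ℝ) < n := by exact_mod_cast hn
  set ε := -D y * a / (2 * n * b) with hε
  have hε0 : 0 < ε := by positivity
  have hFε : ∀ i, ContDiffOn ℝ 1 (fun x => F i x + ε * x i) U := fun i =>
    (hF i).add (by fun_prop)
  have hdiv : ∀ x ∈ U, ∑ i, fderiv ℝ (fun x => F i x + ε * x i) x (EuclideanSpace.single i 1) =
      D x + n * ε := by
    intro x hx
    have : ∀ i, fderiv ℝ (fun x => F i x + ε * x i) x (EuclideanSpace.single i 1) =
        fderiv ℝ (F i) x (EuclideanSpace.single i 1) + ε := by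
      intro i
      have h1 : HasFDerivAt (F i) _ x :=
        (((hF i).differentiableOn (by norm_num)).differentiableAt (hU.mem_nhds hx)).hasFDerivAt
      have h2 : HasFDerivAt (fun x : EuclideanSpace ℝ (Fin n) => ε * x i)
          (ε • (EuclideanSpace.proj i : EuclideanSpace ℝ (Fin n) →L[ℝ] ℝ)) x :=
        ((EuclideanSpace.proj i : EuclideanSpace ℝ (Fin n) →L[ℝ] ℝ).hasFDerivAt).const_mul ε
      rw [(h1.fun_add h2).fderiv]
      simp
    simp_rw [this, Finset.sum_add_distrib]
    simp [hD]
  have hposε : ∀ x ∈ sphere (0 : EuclideanSpace ℝ (Fin n)) R,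
      0 < ∑ i, x i * (F i x + ε * x i) := by
    intro x hx
    have hxR : ‖x‖ = R := by simpa using hx
    have : ∑ i, x i * (F i x + ε * x i) = ∑ i, x i * F i x + ε * ‖x‖ ^ 2 := by
      rw [EuclideanSpace.real_norm_sq_eq, Finset.mul_sum, ← Finset.sum_add_distrib]
      exact Finset.sum_congr rfl fun i _ => by ring
    rw [this, hxR]
    have := hnonneg x hx
    positivity
  obtain ⟨φ, h0, h1, hone, hzero, hint, hge⟩ :=
    exists_cutoff_integral_divergence_nonneg hR hU hRU hFε hposε
  have hi1 : Integrable ((ball (0 : EuclideanSpace ℝ (Fin n)) R).indicator fun _ => (n * ε)) :=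
    (integrable_indicator_iff measurableSet_ball).2
      (integrableOn_const measure_ball_lt_top.ne)
  have hi2 : Integrable ((closedBall (0 : EuclideanSpace ℝ (Fin n)) (R / 2)).indicator
      fun _ => D y) :=
    (integrable_indicator_iff measurableSet_closedBall).2
      (integrableOn_const measure_closedBall_lt_top.ne)
  have hle := integral_mono hint (hi1.add hi2) fun x => by
    simp only [Pi.add_apply]
    by_cases hx : x ∈ ball (0 : EuclideanSpace ℝ (Fin n)) R
    · rw [hdiv x (hRU (ball_subset_closedBall hx)), indicator_of_mem hx]
      by_cases hx2 : x ∈ closedBall (0 : EuclideanSpace ℝ (Fin n)) (R / 2)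
      · rw [indicator_of_mem hx2, hone x hx2]
        have : D x ≤ D y := hmax hx2
        linarith
      · rw [indicator_of_notMem hx2]
        have h3 := hneg x hx
        have : φ x * (n * ε) ≤ 1 * (n * ε) := mul_le_mul_of_nonneg_right (h1 x) (by positivity)
        have : φ x * D x ≤ 0 := mul_nonpos_of_nonneg_of_nonpos (h0 x) h3.le
        linarith
    · rw [hzero x hx, indicator_of_notMem hx, indicator_of_notMem fun h => hx (hhalf h)]
      simp
  simp only [Pi.add_apply] at hle
  rw [integral_add hi1 hi2, integral_indicator measurableSet_ball,
    integral_indicator measurableSet_closedBall, setIntegral_const, setIntegral_const] at hle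
  simp only [smul_eq_mul, ← ha, ← hb] at hle
  have : b * (n * ε) = -D y * a / 2 := by
    rw [hε]
    field_simp
  nlinarith [mul_pos ha0 hm]

/-- The Rellich–Pohožaev vector field of the pair `w`, `v`, with potential `H` and weight `c`. -/
def pohozaevField {n : ℕ} (w v H : EuclideanSpace ℝ (Fin n) → ℝ) (c : ℝ) (i : Fin n)
    (x : EuclideanSpace ℝ (Fin n)) : ℝ :=
  fderiv ℝ w x x * fderiv ℝ v x (EuclideanSpace.single i 1) +
    fderiv ℝ v x x * fderiv ℝ w x (EuclideanSpace.single i 1) -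
    (∑ j, fderiv ℝ w x (EuclideanSpace.single j 1) * fderiv ℝ v x (EuclideanSpace.single j 1)) *
      x i +
    H x * x i +
    c * (w x * fderiv ℝ v x (EuclideanSpace.single i 1) +
      v x * fderiv ℝ w x (EuclideanSpace.single i 1))

theorem contDiffOn_pohozaevField {n : ℕ} {U : Set (EuclideanSpace ℝ (Fin n))} (hU : IsOpen U)
    {w v H : EuclideanSpace ℝ (Fin n) → ℝ} (hw : ContDiffOn ℝ 2 w U) (hv : ContDiffOn ℝ 2 v U)
    (hH : ContDiffOn ℝ 1 H U) (c : ℝ) (i : Fin n) :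
    ContDiffOn ℝ 1 (pohozaevField w v H c i) U := by
  have hw' : ContDiffOn ℝ 1 (fderiv ℝ w) U := hw.fderiv_of_isOpen hU (by norm_num)
  have hv' : ContDiffOn ℝ 1 (fderiv ℝ v) U := hv.fderiv_of_isOpen hU (by norm_num)
  have hwe : ∀ e, ContDiffOn ℝ 1 (fun x => fderiv ℝ w x e) U := fun e =>
    hw'.clm_apply contDiffOn_const
  have hve : ∀ e, ContDiffOn ℝ 1 (fun x => fderiv ℝ v x e) U := fun e =>
    hv'.clm_apply contDiffOn_const
  have hwx : ContDiffOn ℝ 1 (fun x => fderiv ℝ w x x) U := hw'.clm_apply contDiffOn_id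
  have hvx : ContDiffOn ℝ 1 (fun x => fderiv ℝ v x x) U := hv'.clm_apply contDiffOn_id
  have hw1 : ContDiffOn ℝ 1 w U := hw.of_le (by norm_num)
  have hv1 : ContDiffOn ℝ 1 v U := hv.of_le (by norm_num)
  have hx : ContDiffOn ℝ 1 (fun x : EuclideanSpace ℝ (Fin n) => x i) U := by fun_prop
  exact ((((hwx.mul (hve _)).add (hvx.mul (hwe _))).sub
    ((ContDiffOn.sum fun j _ => (hwe _).mul (hve _)).mul hx)).add (hH.mul hx)).add
    (contDiffOn_const.mul ((hw1.mul (hve _)).add (hv1.mul (hwe _))))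

theorem sum_apply_single_mul {n : ℕ} (L : EuclideanSpace ℝ (Fin n) →L[ℝ] ℝ)
    (x : EuclideanSpace ℝ (Fin n)) :
    ∑ i, L (EuclideanSpace.single i 1) * x i = L x := by
  conv_rhs => rw [← (EuclideanSpace.basisFun (Fin n) ℝ).sum_repr x, map_sum]
  simp [mul_comm]

theorem lap_eq_sum {n : ℕ} {w : EuclideanSpace ℝ (Fin n) → ℝ} {x : EuclideanSpace ℝ (Fin n)}
    (hw : DifferentiableAt ℝ (fderiv ℝ w) x) :
    lap w x = ∑ i, fderiv ℝ (fderiv ℝ w) x (EuclideanSpace.single i 1)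
      (EuclideanSpace.single i 1) := by
  refine Finset.sum_congr rfl fun i _ => ?_
  rw [(hw.hasFDerivAt.clm_apply (hasFDerivAt_const _ x)).fderiv]
  simp

/-- The Rellich–Pohožaev identity in differential form. -/
theorem divergence_pohozaevField {n : ℕ} {w v H : EuclideanSpace ℝ (Fin n) → ℝ}
    {x : EuclideanSpace ℝ (Fin n)} (hw : ContDiffAt ℝ 2 w x) (hv : ContDiffAt ℝ 2 v x)
    (hH : DifferentiableAt ℝ H x) (c : ℝ) :
    ∑ i, fderiv ℝ (pohozaevField w v H c i) x (EuclideanSpace.single i 1) =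
      fderiv ℝ w x x * lap v x + fderiv ℝ v x x * lap w x + fderiv ℝ H x x + n * H x +
      c * (w x * lap v x + v x * lap w x) +
      (2 - n + 2 * c) * ∑ j, fderiv ℝ w x (EuclideanSpace.single j 1) *
        fderiv ℝ v x (EuclideanSpace.single j 1) := by
  have hw' : DifferentiableAt ℝ (fderiv ℝ w) x :=
    (hw.fderiv_right (m := 1) (by norm_num)).differentiableAt (by norm_num)
  have hv' : DifferentiableAt ℝ (fderiv ℝ v) x :=
    (hv.fderiv_right (m := 1) (by norm_num)).differentiableAt (by norm_num)
  have hws : IsSymmSndFDerivAt ℝ w x := hw.isSymmSndFDerivAt (by simp)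
  have hvs : IsSymmSndFDerivAt ℝ v x := hv.isSymmSndFDerivAt (by simp)
  rw [lap_eq_sum hw', lap_eq_sum hv']
  have hw1 := (hw.differentiableAt (by norm_num)).hasFDerivAt
  have hv1 := (hv.differentiableAt (by norm_num)).hasFDerivAt
  have hwe : ∀ e, HasFDerivAt (fun y => fderiv ℝ w y e) ((fderiv ℝ (fderiv ℝ w) x).flip e) x :=
    fun e => by simpa using hw'.hasFDerivAt.clm_apply (hasFDerivAt_const e x)
  have hve : ∀ e, HasFDerivAt (fun y => fderiv ℝ v y e) ((fderiv ℝ (fderiv ℝ v) x).flip e) x :=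
    fun e => by simpa using hv'.hasFDerivAt.clm_apply (hasFDerivAt_const e x)
  have hwx := hw'.hasFDerivAt.clm_apply (hasFDerivAt_id x)
  have hvx := hv'.hasFDerivAt.clm_apply (hasFDerivAt_id x)
  simp only [id_eq] at hwx hvx
  have hx : ∀ i, HasFDerivAt (fun y : EuclideanSpace ℝ (Fin n) => y i)
      (EuclideanSpace.proj i : EuclideanSpace ℝ (Fin n) →L[ℝ] ℝ) x := fun i =>
    (EuclideanSpace.proj i : EuclideanSpace ℝ (Fin n) →L[ℝ] ℝ).hasFDerivAt
  have key : ∀ i, HasFDerivAt (pohozaevField w v H c i) _ x := fun i =>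
    ((((hwx.fun_mul (hve (EuclideanSpace.single i 1))).fun_add
      (hvx.fun_mul (hwe (EuclideanSpace.single i 1)))).fun_sub
      ((HasFDerivAt.fun_sum fun j (_ : j ∈ Finset.univ) =>
        (hwe (EuclideanSpace.single j 1)).fun_mul (hve (EuclideanSpace.single j 1))).fun_mul
          (hx i))).fun_add
      (hH.hasFDerivAt.fun_mul (hx i))).fun_add
    (((hw1.fun_mul (hve (EuclideanSpace.single i 1))).fun_add
      (hv1.fun_mul (hwe (EuclideanSpace.single i 1)))).const_mul c)
  set A := fderiv ℝ (fderiv ℝ w) x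
  set B := fderiv ℝ (fderiv ℝ v) x
  set a := fderiv ℝ w x
  set b := fderiv ℝ v x
  have hA : ∀ j, ∑ i, x i * A (EuclideanSpace.single i 1) (EuclideanSpace.single j 1) =
      A (EuclideanSpace.single j 1) x := fun j => by
    refine Eq.trans ?_ ((sum_apply_single_mul (A.flip (EuclideanSpace.single j 1)) x).trans
      (hws.eq x _))
    exact Finset.sum_congr rfl fun i _ => mul_comm _ _
  have hB : ∀ j, ∑ i, x i * B (EuclideanSpace.single i 1) (EuclideanSpace.single j 1) =
      B (EuclideanSpace.single j 1) x := fun j => by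
    refine Eq.trans ?_ ((sum_apply_single_mul (B.flip (EuclideanSpace.single j 1)) x).trans
      (hvs.eq x _))
    exact Finset.sum_congr rfl fun i _ => mul_comm _ _
  have hsum : ∑ i, x i * ∑ j,
      (a (EuclideanSpace.single j 1) *
        B (EuclideanSpace.single i 1) (EuclideanSpace.single j 1) +
      b (EuclideanSpace.single j 1) *
        A (EuclideanSpace.single i 1) (EuclideanSpace.single j 1)) =
      ∑ j, (a (EuclideanSpace.single j 1) * B (EuclideanSpace.single j 1) x +
        b (EuclideanSpace.single j 1) * A (EuclideanSpace.single j 1) x) := by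
    simp_rw [← hA, ← hB, Finset.mul_sum]
    rw [Finset.sum_comm]
    refine Finset.sum_congr rfl fun j _ => ?_
    rw [← Finset.sum_add_distrib]
    exact Finset.sum_congr rfl fun i _ => by ring
  have hproj : ∀ i, (EuclideanSpace.proj i : EuclideanSpace ℝ (Fin n) →L[ℝ] ℝ)
      (EuclideanSpace.single i 1) = 1 := fun i => by simp
  simp_rw [fun i => (key i).fderiv]
  simp only [add_apply, sub_apply,
    smul_apply, ContinuousLinearMap.flip_apply, sum_apply,
    ContinuousLinearMap.comp_apply, ContinuousLinearMap.id_apply, hproj, smul_eq_mul, mul_one, Finset.sum_add_distrib,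
    Finset.sum_sub_distrib, Finset.sum_const, Finset.card_univ, Fintype.card_fin, nsmul_eq_mul,
    mul_add, ← Finset.mul_sum] at hsum ⊢
  have hDH := sum_apply_single_mul (fderiv ℝ H x) x
  have hcomm : ∑ i, b (EuclideanSpace.single i 1) * a (EuclideanSpace.single i 1) =
      ∑ i, a (EuclideanSpace.single i 1) * b (EuclideanSpace.single i 1) :=
    Finset.sum_congr rfl fun i _ => mul_comm _ _
  simp_rw [mul_comm (x.ofLp _) (fderiv ℝ H x _)]
  rw [hDH, hcomm]
  linear_combination -hsum

theorem exists_gradient_eq_neg_smul {n : ℕ} {R : ℝ} (hR : 0 < R)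
    {w : EuclideanSpace ℝ (Fin n) → ℝ} {x : EuclideanSpace ℝ (Fin n)} (hx : x ∈ sphere 0 R)
    (hw : DifferentiableAt ℝ w x) (hmin : ∀ y ∈ closedBall 0 R, w x ≤ w y) :
    ∃ μ : ℝ, 0 ≤ μ ∧ ∀ y, fderiv ℝ w x y = -μ * inner ℝ x y := by
  have hxR : ‖x‖ = R := by simpa using hx
  have hmin' : IsLocalMinOn w (closedBall 0 R) x := IsMinOn.localize hmin
  have h1 : ∀ y ∈ closedBall (0 : EuclideanSpace ℝ (Fin n)) R, 0 ≤ fderiv ℝ w x (y - x) :=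
    fun y hy => hmin'.hasFDerivWithinAt_nonneg hw.hasFDerivAt.hasFDerivWithinAt
      (sub_mem_posTangentConeAt_of_segment_subset
        ((convex_closedBall _ _).segment_subset (sphere_subset_closedBall hx) hy))
  set g := (InnerProductSpace.toDual ℝ (EuclideanSpace ℝ (Fin n))).symm (fderiv ℝ w x) with hg
  have hgi : ∀ y, fderiv ℝ w x y = inner ℝ g y := fun y => by
    rw [hg, InnerProductSpace.toDual_symm_apply]
  refine ⟨‖g‖ / R, by positivity, fun y => ?_⟩
  rcases eq_or_ne g 0 with h0 | h0
  · simp [hgi, h0]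
  have hg0 : 0 < ‖g‖ := norm_pos_iff.2 h0
  have h2 := h1 (-(R / ‖g‖) • g) (by
    rw [mem_closedBall, dist_zero_right, norm_smul, norm_neg, Real.norm_of_nonneg (by positivity)]
    field_simp
    exact le_rfl)
  rw [hgi, inner_sub_right, inner_smul_right, real_inner_self_eq_norm_sq] at h2
  have h3 : -(R / ‖g‖) * ‖g‖ ^ 2 = -(R * ‖g‖) := by field_simp
  have h4 : inner ℝ g (-x) = ‖g‖ * ‖-x‖ := by
    refine le_antisymm (real_inner_le_norm _ _) ?_
    rw [inner_neg_right, norm_neg, hxR]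
    linarith
  rw [inner_eq_norm_mul_iff_real, norm_neg, hxR] at h4
  have h5 : g = (-(‖g‖ / R)) • x := by
    calc g = R⁻¹ • (R • g) := by rw [smul_smul, inv_mul_cancel₀ hR.ne', one_smul]
      _ = (-(‖g‖ / R)) • x := by
        rw [h4, smul_smul, smul_neg, neg_smul]
        congr 2
        ring
  rw [hgi]
  conv_lhs => rw [h5]
  rw [real_inner_smul_left]

theorem sum_mul_pohozaevField_nonneg {n : ℕ} {R : ℝ} (hR : 0 < R)
    {w v H : EuclideanSpace ℝ (Fin n) → ℝ} {x : EuclideanSpace ℝ (Fin n)} (hx : x ∈ sphere 0 R)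
    (hw : DifferentiableAt ℝ w x) (hv : DifferentiableAt ℝ v x)
    (hwn : ∀ y ∈ closedBall 0 R, 0 ≤ w y) (hvn : ∀ y ∈ closedBall 0 R, 0 ≤ v y)
    (hwx : w x = 0) (hvx : v x = 0) (hHx : H x = 0) (c : ℝ) :
    0 ≤ ∑ i, x i * pohozaevField w v H c i x := by
  have hxR : ‖x‖ = R := by simpa using hx
  obtain ⟨μ, hμ, hwg⟩ := exists_gradient_eq_neg_smul hR hx hw (by simpa [hwx] using hwn)
  obtain ⟨ν, hν, hvg⟩ := exists_gradient_eq_neg_smul hR hx hv (by simpa [hvx] using hvn)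
  have hsq : ∑ i, x i ^ 2 = R ^ 2 := by rw [← EuclideanSpace.real_norm_sq_eq, hxR]
  have : ∀ i, x i * pohozaevField w v H c i x = μ * ν * R ^ 2 * x i ^ 2 := by
    intro i
    have hs : ∑ j, -μ * x j * (-ν * x j) = μ * ν * R ^ 2 := by
      rw [← hsq, Finset.mul_sum]
      exact Finset.sum_congr rfl fun j _ => by ring
    simp only [pohozaevField, hwg, hvg, hwx, hvx, hHx, real_inner_self_eq_norm_sq, hxR,
      EuclideanSpace.inner_single_right, one_mul, conj_trivial, hs]
    ring
  simp_rw [this, ← Finset.mul_sum, hsq]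
  positivity

theorem lap_add_const_mul {n : ℕ} {u v : EuclideanSpace ℝ (Fin n) → ℝ}
    {x : EuclideanSpace ℝ (Fin n)} (hu : ContDiffAt ℝ 2 u x) (hv : ContDiffAt ℝ 2 v x) (a : ℝ) :
    lap (fun y => u y + a * v y) x = lap u x + a * lap v x := by
  have hev : fderiv ℝ (fun y => u y + a * v y) =ᶠ[nhds x]
      fun y => fderiv ℝ u y + a • fderiv ℝ v y := by
    filter_upwards [hu.eventually (by simp), hv.eventually (by simp)] with y hy1 hy2
    exact ((hy1.differentiableAt (by norm_num)).hasFDerivAt.fun_add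
      ((hy2.differentiableAt (by norm_num)).hasFDerivAt.const_mul a)).fderiv
  have hu' : DifferentiableAt ℝ (fderiv ℝ u) x :=
    (hu.fderiv_right (m := 1) (by norm_num)).differentiableAt (by norm_num)
  have hv' : DifferentiableAt ℝ (fderiv ℝ v) x :=
    (hv.fderiv_right (m := 1) (by norm_num)).differentiableAt (by norm_num)
  have h := hu'.hasFDerivAt.fun_add (hv'.hasFDerivAt.const_smul a)
  have h' := h.congr_of_eventuallyEq hev
  rw [lap_eq_sum h'.differentiableAt, h'.fderiv, lap_eq_sum hu', lap_eq_sum hv', Finset.mul_sum,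
    ← Finset.sum_add_distrib]
  rfl

/-- **Nonexistence for the Dirichlet problem** of the system
`-Δu = v^p + v^q - u^p`, `-Δv = u^p` on any ball of radius `R`, when `p ≠ q` and
`p, q ≥ (n+2)/(n-2)`. -/
theorem example2_Dirichlet_nonexistence (n : ℕ) (hn : 3 ≤ n) (p q : ℝ) (hpq : p ≠ q)
    (hp : ((n:ℝ) + 2) / ((n:ℝ) - 2) ≤ p) (hq : ((n:ℝ) + 2) / ((n:ℝ) - 2) ≤ q)
    (R : ℝ) (hR : 0 < R) :
    ¬ ∃ (u v : EuclideanSpace ℝ (Fin n) → ℝ) (U : Set (EuclideanSpace ℝ (Fin n))),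
      IsOpen U ∧ closedBall (0 : EuclideanSpace ℝ (Fin n)) R ⊆ U ∧
      ContDiffOn ℝ 2 u U ∧ ContDiffOn ℝ 2 v U ∧
      (∀ x ∈ ball (0 : EuclideanSpace ℝ (Fin n)) R,
        - lap u x = v x ^ p + v x ^ q - u x ^ p) ∧
      (∀ x ∈ ball (0 : EuclideanSpace ℝ (Fin n)) R, - lap v x = u x ^ p) ∧
      (∀ x ∈ ball (0 : EuclideanSpace ℝ (Fin n)) R, 0 < u x) ∧
      (∀ x ∈ ball (0 : EuclideanSpace ℝ (Fin n)) R, 0 < v x) ∧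
      (∀ x ∈ sphere (0 : EuclideanSpace ℝ (Fin n)) R, u x = 0) ∧
      (∀ x ∈ sphere (0 : EuclideanSpace ℝ (Fin n)) R, v x = 0) := by
  rintro ⟨u, v, U, hU, hRU, hu, hv, heu, hev, hup, hvp, hu0, hv0⟩
  have hn' : (3 : ℝ) ≤ n := by exact_mod_cast hn
  have hn2 : (0 : ℝ) < n - 2 := by linarith
  rw [div_le_iff₀ hn2] at hp hq
  have hp0 : 0 < p := by
    by_contra! h
    nlinarith
  have hq0 : 0 < q := by
    by_contra! h
    nlinarith
  have hBU : ∀ x ∈ ball (0 : EuclideanSpace ℝ (Fin n)) R, x ∈ U := fun x hx =>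
    hRU (ball_subset_closedBall hx)
  set w : EuclideanSpace ℝ (Fin n) → ℝ := fun x => u x + 1 / 2 * v x with hw
  set H : EuclideanSpace ℝ (Fin n) → ℝ := fun x =>
    (p + 1)⁻¹ * (u x ^ (p + 1) + v x ^ (p + 1)) + (q + 1)⁻¹ * v x ^ (q + 1) with hH
  have hwd : ContDiffOn ℝ 2 w U := hu.add (contDiffOn_const.mul hv)
  have hpow : ∀ r : ℝ, 0 < r → ContDiff ℝ 1 fun t : ℝ => t ^ (r + 1) := fun r hr =>
    Real.contDiff_rpow_const_of_le (n := 1) (by push_cast; linarith)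
  have hu1 : ContDiffOn ℝ 1 u U := hu.of_le (by norm_num)
  have hv1 : ContDiffOn ℝ 1 v U := hv.of_le (by norm_num)
  have hHd : ContDiffOn ℝ 1 H U :=
    (contDiffOn_const.mul (((hpow p hp0).comp_contDiffOn hu1).add
      ((hpow p hp0).comp_contDiffOn hv1))).add
      (contDiffOn_const.mul ((hpow q hq0).comp_contDiffOn hv1))
  have hnonneg : ∀ f : EuclideanSpace ℝ (Fin n) → ℝ, (∀ x ∈ ball 0 R, 0 < f x) →
      (∀ x ∈ sphere 0 R, f x = 0) → ∀ x ∈ closedBall 0 R, 0 ≤ f x := by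
    intro f h1 h2 x hx
    rw [← ball_union_sphere] at hx
    exact hx.elim (fun h => (h1 x h).le) fun h => (h2 x h).ge
  have hun := hnonneg u hup hu0
  have hvn := hnonneg v hvp hv0
  refine false_of_divergence_neg (F := pohozaevField w v H ((n - 2) / 2)) (by omega) hR hU hRU
    (contDiffOn_pohozaevField hU hwd hv hHd _) (fun x hx => ?_) fun x hx => ?_
  · have hxU : U ∈ nhds x := hU.mem_nhds (hRU (sphere_subset_closedBall hx))
    refine sum_mul_pohozaevField_nonneg hR hx
      ((hwd.contDiffAt hxU).differentiableAt (by norm_num))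
      ((hv.contDiffAt hxU).differentiableAt (by norm_num)) (fun y hy => ?_) hvn ?_ (hv0 x hx) ?_ _
    · have := hun y hy
      have := hvn y hy
      positivity
    · simp [hw, hu0 x hx, hv0 x hx]
    · simp [hH, hu0 x hx, hv0 x hx, Real.zero_rpow (by linarith : p + 1 ≠ 0),
        Real.zero_rpow (by linarith : q + 1 ≠ 0)]
  · have hxU : U ∈ nhds x := hU.mem_nhds (hBU x hx)
    have hux := hup x hx
    have hvx := hvp x hx
    have hu' := ((hu.contDiffAt hxU).differentiableAt (by norm_num)).hasFDerivAt
    have hv' := ((hv.contDiffAt hxU).differentiableAt (by norm_num)).hasFDerivAt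
    have hwx : fderiv ℝ w x x = fderiv ℝ u x x + 1 / 2 * fderiv ℝ v x x := by
      rw [(hu'.fun_add (hv'.const_mul (1 / 2))).fderiv]
      simp
    have hHx : fderiv ℝ H x x =
        u x ^ p * fderiv ℝ u x x + (v x ^ p + v x ^ q) * fderiv ℝ v x x := by
      have h : HasFDerivAt H _ x :=
        (((hu'.rpow_const (p := p + 1) (Or.inl hux.ne')).fun_add
          (hv'.rpow_const (p := p + 1) (Or.inl hvx.ne'))).const_mul (p + 1)⁻¹).fun_add
          ((hv'.rpow_const (p := q + 1) (Or.inl hvx.ne')).const_mul (q + 1)⁻¹)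
      rw [h.fderiv]
      simp
      field_simp
      ring
    have hlv : lap v x = -u x ^ p := by linarith [hev x hx]
    have hlu : lap u x = -(v x ^ p + v x ^ q - u x ^ p) := by linarith [heu x hx]
    rw [divergence_pohozaevField (hwd.contDiffAt hxU) (hv.contDiffAt hxU)
      ((hHd.contDiffAt hxU).differentiableAt (by norm_num)), hwx, hHx,
      lap_add_const_mul (hu.contDiffAt hxU) (hv.contDiffAt hxU), hlu, hlv]
    simp only [hH, hw, Real.rpow_add_one hux.ne', Real.rpow_add_one hvx.ne']
    have hP : 0 < u x ^ p * u x + v x ^ p * v x := by positivity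
    have hQ : 0 < v x ^ q * v x := by positivity
    have hcp : n * (p + 1)⁻¹ ≤ (n - 2) / 2 := by
      rw [← div_eq_mul_inv, div_le_iff₀ (by linarith)]
      linarith
    have hcq : n * (q + 1)⁻¹ ≤ (n - 2) / 2 := by
      rw [← div_eq_mul_inv, div_le_iff₀ (by linarith)]
      linarith
    have hne : n * (p + 1)⁻¹ ≠ n * (q + 1)⁻¹ := fun h => hpq <| by
      have := inv_injective (mul_left_cancel₀ (by linarith : (n : ℝ) ≠ 0) h)
      linarith
    have hlt : (n * (p + 1)⁻¹ - (n - 2) / 2) * (u x ^ p * u x + v x ^ p * v x) +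
        (n * (q + 1)⁻¹ - (n - 2) / 2) * (v x ^ q * v x) < 0 := by
      rcases hcp.lt_or_eq with h | h
      · exact add_neg_of_neg_of_nonpos (mul_neg_of_neg_of_pos (by linarith) hP)
          (mul_nonpos_of_nonpos_of_nonneg (by linarith) hQ.le)
      · exact add_neg_of_nonpos_of_neg (mul_nonpos_of_nonpos_of_nonneg (by linarith) hP.le)
          (mul_neg_of_neg_of_pos (sub_neg.2 (lt_of_le_of_ne hcq fun h' => hne (h.trans h'.symm))) hQ)
    refine lt_of_eq_of_lt ?_ hlt
    ring
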